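/- Let Ω be a finite set and P an ℓ-step probability distribution on Ω^ℓ with equal marginals π (with support all of Ω), with ρ(P) ≤ ρ < 1. For every τ > 0, set k := ⌊2ℓ/(τ(1−ρ²))⌋ and β := (τ(1−ρ²)/(2ℓ|Ω|^{ℓ+1}))^k. Then for every ε ∈ [0,1], every n ≥ 1, and all functions f^{(1)},…,f^{(ℓ)} : Ωⁿ → [0,1] each of which is ε-resilient up to size k, there exist functions g^{(1)},…,g^{(ℓ)} : Ωⁿ → [0,1] such that: (i) max_{j∈[ℓ]} max_{i∈[n]} Inf_i(g^{(j)}(X^{(j)})) ≤ τ; (ii) E[∏_{j=1}^ℓ f^{(j)}(X^{(j)})] ≥ β · E[∏_{j=1}^ℓ g^{(j)}(X^{(j)})]; (iii) for all j ∈ [ℓ], E[g^{(j)}(X^{(j)})] ≥ (1−ε)·E[f^{(j)}(X^{(j)})]. -/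

import Mathlib

namespace SameSetHitting

/-- `P` is a probability distribution on a finite type. -/
def IsDist {α : Type} [Fintype α] (P : α → ℝ) : Prop :=
  (∀ x, 0 ≤ P x) ∧ ∑ x, P x = 1

open Classical in
/-- The `j`-th marginal of an `ℓ`-step distribution `P`. -/
noncomputable def marginal {Ω : Type} [Fintype Ω] {ℓ : ℕ}
    (P : (Fin ℓ → Ω) → ℝ) (j : Fin ℓ) (a : Ω) : ℝ :=
  ∑ x : Fin ℓ → Ω, if x j = a then P x else 0

/-- All `ℓ` marginals of `P` are equal to `π`. -/
def HasMarginals {Ω : Type} [Fintype Ω] {ℓ : ℕ}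
    (P : (Fin ℓ → Ω) → ℝ) (π : Ω → ℝ) : Prop :=
  ∀ j a, marginal P j a = π a

/-- The expectation `E[f(X)]` where `X` has the product law `πⁿ`. -/
noncomputable def exps {Ω : Type} [Fintype Ω] {n : ℕ}
    (π : Ω → ℝ) (f : (Fin n → Ω) → ℝ) : ℝ :=
  ∑ v : Fin n → Ω, (∏ i, π (v i)) * f v

/-- `E[∏_{j} f_j(X^{(j)})]` where the tuples `(X_i^{(1)}, …, X_i^{(ℓ)})`,
`i = 1, …, n`, are i.i.d. with law `P` and `X^{(j)} = (X_1^{(j)}, …, X_n^{(j)})`. -/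
noncomputable def prodExp {Ω : Type} [Fintype Ω] {ℓ n : ℕ}
    (P : (Fin ℓ → Ω) → ℝ) (f : Fin ℓ → ((Fin n → Ω) → ℝ)) : ℝ :=
  ∑ x : Fin ℓ → Fin n → Ω, (∏ i, P (fun j => x j i)) * ∏ j, f j (x j)

/-- Expectation under the single-coordinate multi-step distribution `P`. -/
noncomputable def expP {Ω : Type} [Fintype Ω] {ℓ : ℕ}
    (P : (Fin ℓ → Ω) → ℝ) (f : (Fin ℓ → Ω) → ℝ) : ℝ :=
  ∑ x, P x * f x

/-- Covariance under `P`. -/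
noncomputable def covP {Ω : Type} [Fintype Ω] {ℓ : ℕ}
    (P : (Fin ℓ → Ω) → ℝ) (f g : (Fin ℓ → Ω) → ℝ) : ℝ :=
  expP P (fun x => f x * g x) - expP P f * expP P g

/-- Variance under `P`. -/
noncomputable def varP {Ω : Type} [Fintype Ω] {ℓ : ℕ}
    (P : (Fin ℓ → Ω) → ℝ) (f : (Fin ℓ → Ω) → ℝ) : ℝ :=
  covP P f f

/-- `f` depends only on the coordinates in `S`. -/
def DependsOn {Ω : Type} {ℓ : ℕ} (f : (Fin ℓ → Ω) → ℝ) (S : Finset (Fin ℓ)) : Prop :=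
  ∀ x y : Fin ℓ → Ω, (∀ j ∈ S, x j = y j) → f x = f y

/-- The correlation `ρ(P, S, T)`. -/
noncomputable def rhoST {Ω : Type} [Fintype Ω] {ℓ : ℕ}
    (P : (Fin ℓ → Ω) → ℝ) (S T : Finset (Fin ℓ)) : ℝ :=
  sSup {r : ℝ | ∃ f g : (Fin ℓ → Ω) → ℝ, DependsOn f S ∧ DependsOn g T ∧
    varP P f = 1 ∧ varP P g = 1 ∧ r = covP P f g}

/-- The correlation `ρ(P) = max_j ρ(P, {j}, [ℓ]∖{j})`. -/
noncomputable def rho {Ω : Type} [Fintype Ω] {ℓ : ℕ} (P : (Fin ℓ → Ω) → ℝ) : ℝ :=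
  ⨆ j : Fin ℓ, rhoST P {j} ({j}ᶜ)

/-- Expectation under the single-step distribution `π`. -/
noncomputable def expPi {Ω : Type} [Fintype Ω] (π : Ω → ℝ) (f : Ω → ℝ) : ℝ :=
  ∑ a, π a * f a

/-- Variance under the single-step distribution `π`. -/
noncomputable def varPi {Ω : Type} [Fintype Ω] (π : Ω → ℝ) (f : Ω → ℝ) : ℝ :=
  expPi π (fun a => (f a - expPi π f) ^ 2)

/-- The influence `Inf_i(f(X))` of coordinate `i`, where `X` has product law `πⁿ`. -/
noncomputable def influence {Ω : Type} [Fintype Ω] {n : ℕ}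
    (π : Ω → ℝ) (i : Fin n) (f : (Fin n → Ω) → ℝ) : ℝ :=
  ∑ v : Fin n → Ω, (∏ k, π (v k)) * varPi π (fun a => f (Function.update v i a))

/-- The function obtained from `f` by applying the restriction `R`
(`none` means unrestricted). -/
def restrict {Ω : Type} {n : ℕ} (R : Fin n → Option Ω)
    (f : (Fin n → Ω) → ℝ) : (Fin n → Ω) → ℝ :=
  fun x => f (fun i => (R i).getD (x i))

/-- The size (number of restricted coordinates) of a restriction. -/
def restSize {Ω : Type} {n : ℕ} (R : Fin n → Option Ω) : ℕ :=
  (Finset.univ.filter (fun i => (R i).isSome = true)).card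

/-- `f` is `ε`-resilient up to size `k` (with respect to the product law `πⁿ`). -/
def Resilient {Ω : Type} [Fintype Ω] {n : ℕ} (π : Ω → ℝ) (ε : ℝ) (k : ℕ)
    (f : (Fin n → Ω) → ℝ) : Prop :=
  ∀ R : Fin n → Option Ω, restSize R ≤ k →
    (1 - ε) * exps π f ≤ exps π (restrict R f) ∧
    exps π (restrict R f) ≤ (1 + ε) * exps π f

/-- The restriction operator `R[i,a]`. -/
def restrOp {Ω : Type} {n : ℕ} (i : Fin n) (a : Ω)
    (f : (Fin n → Ω) → ℝ) : (Fin n → Ω) → ℝ :=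
  fun x => f (Function.update x i a)

/-- The maximum operator `M[i,y,z]`. -/
def maxOp {Ω : Type} {n : ℕ} (i : Fin n) (y z : Ω)
    (f : (Fin n → Ω) → ℝ) : (Fin n → Ω) → ℝ :=
  fun x => max (f (Function.update x i y)) (f (Function.update x i z))

/-- Insert the value `a` at position `j` into `w : Ω^{[ℓ] ∖ {j}}`. -/
def ins {Ω : Type} {ℓ : ℕ} (j : Fin ℓ) (w : {k : Fin ℓ // k ≠ j} → Ω) (a : Ω) :
    Fin ℓ → Ω :=
  fun k => if h : k = j then a else w ⟨k, h⟩

/-- The probability that the coordinates other than `j` equal `w`. -/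
noncomputable def margOff {Ω : Type} [Fintype Ω] {ℓ : ℕ}
    (P : (Fin ℓ → Ω) → ℝ) (j : Fin ℓ) (w : {k : Fin ℓ // k ≠ j} → Ω) : ℝ :=
  ∑ a, P (ins j w a)

open Classical in
/-- The joint law of `(Y, Z)` for a double sample on step `j` from `P`. -/
noncomputable def doubleSample {Ω : Type} [Fintype Ω] {ℓ : ℕ}
    (P : (Fin ℓ → Ω) → ℝ) (j : Fin ℓ) (y z : Ω) : ℝ :=
  ∑ w : {k : Fin ℓ // k ≠ j} → Ω,
    if margOff P j w = 0 then 0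
    else P (ins j w y) * P (ins j w z) / margOff P j w



/-! ### Resampling -/

lemma sum_swap_update {ι α : Type} [Fintype ι] [DecidableEq ι] [Fintype α] (i : ι)
    (F : (ι → α) → α → ℝ) :
    ∑ v, ∑ a, F v a = ∑ v, ∑ a, F (Function.update v i a) (v i) := by
  have hinv : Function.Involutive
      (fun p : (ι → α) × α => ((Function.update p.1 i p.2, p.1 i) : (ι → α) × α)) := by
    rintro ⟨v, a⟩
    simp
  have h := Equiv.sum_comp hinv.toPerm (fun p : (ι → α) × α => F p.1 p.2)
  rw [Fintype.sum_prod_type, Fintype.sum_prod_type] at h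
  exact h.symm

lemma prod_update_mul {n : ℕ} {α : Type} (D : α → ℝ) (i : Fin n) (v : Fin n → α) (a : α) :
    (∏ k, D (Function.update v i a k)) * D (v i) = (∏ k, D (v k)) * D a := by
  rw [← Finset.mul_prod_erase Finset.univ _ (Finset.mem_univ i),
    ← Finset.mul_prod_erase Finset.univ (fun k => D (v k)) (Finset.mem_univ i)]
  have : ∏ k ∈ Finset.univ.erase i, D (Function.update v i a k)
      = ∏ k ∈ Finset.univ.erase i, D (v k) := by
    refine Finset.prod_congr rfl fun k hk => ?_
    rw [Function.update_of_ne (Finset.ne_of_mem_erase hk)]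
  rw [this]
  simp
  ring

lemma resample {n : ℕ} {α : Type} [Fintype α] (D : α → ℝ) (hD : ∑ a, D a = 1) (i : Fin n)
    (G : (Fin n → α) → ℝ) :
    ∑ v, (∏ k, D (v k)) * ∑ a, D a * G (Function.update v i a)
      = ∑ v, (∏ k, D (v k)) * G v := by
  have h := sum_swap_update i (fun (v : Fin n → α) a => (∏ k, D (v k)) * D a * G v)
  have h1 : ∑ v : Fin n → α, ∑ a, (∏ k, D (v k)) * D a * G v
      = ∑ v, (∏ k, D (v k)) * G v := by
    refine Finset.sum_congr rfl fun v _ => ?_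
    rw [← Finset.sum_mul, ← Finset.mul_sum, hD, mul_one]
  rw [← h1, h]
  refine Finset.sum_congr rfl fun v _ => ?_
  rw [Finset.mul_sum]
  refine Finset.sum_congr rfl fun a _ => ?_
  rw [prod_update_mul]
  ring

/-! ### Basic facts on expectations -/

lemma sum_pi_one {Ω : Type} [Fintype Ω] {ℓ : ℕ} {P : (Fin ℓ → Ω) → ℝ} {π : Ω → ℝ}
    (hm : HasMarginals P π) (j : Fin ℓ) (φ : Ω → ℝ) :
    ∑ x, P x * φ (x j) = ∑ a, π a * φ a := by
  classical
  have : ∀ a, π a * φ a = ∑ x : Fin ℓ → Ω, if x j = a then P x * φ (x j) else 0 := by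
    intro a
    rw [← hm j a, marginal, Finset.sum_mul]
    refine Finset.sum_congr rfl fun x _ => ?_
    by_cases h : x j = a
    · simp [h]
    · simp [h]
  simp_rw [this]
  rw [Finset.sum_comm]
  simp

lemma pi_total {Ω : Type} [Fintype Ω] {ℓ : ℕ} {P : (Fin ℓ → Ω) → ℝ} {π : Ω → ℝ}
    (hP : IsDist P) (hm : HasMarginals P π) (j : Fin ℓ) : ∑ a, π a = 1 := by
  have := sum_pi_one hm j (fun _ => 1)
  simp only [mul_one] at this
  rw [← this, hP.2]

lemma varP_eq {Ω : Type} [Fintype Ω] {ℓ : ℕ} {P : (Fin ℓ → Ω) → ℝ} (hP : IsDist P)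
    (f : (Fin ℓ → Ω) → ℝ) : varP P f = ∑ x, P x * (f x - expP P f) ^ 2 := by
  have : ∀ x, P x * (f x - expP P f) ^ 2
      = P x * (f x * f x) - 2 * expP P f * (P x * f x) + (expP P f) ^ 2 * P x := by
    intro x; ring
  simp_rw [this]
  rw [Finset.sum_add_distrib, Finset.sum_sub_distrib, ← Finset.mul_sum, ← Finset.mul_sum, hP.2]
  unfold varP covP
  change _ = expP P (fun x => f x * f x) - 2 * expP P f * expP P f + _
  ring

lemma varP_nonneg {Ω : Type} [Fintype Ω] {ℓ : ℕ} {P : (Fin ℓ → Ω) → ℝ} (hP : IsDist P)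
    (f : (Fin ℓ → Ω) → ℝ) : 0 ≤ varP P f := by
  rw [varP_eq hP]
  exact Finset.sum_nonneg fun x _ => mul_nonneg (hP.1 x) (sq_nonneg _)

lemma expP_smul {Ω : Type} [Fintype Ω] {ℓ : ℕ} (P : (Fin ℓ → Ω) → ℝ) (s : ℝ)
    (f : (Fin ℓ → Ω) → ℝ) : expP P (fun x => s * f x) = s * expP P f := by
  unfold expP
  rw [Finset.mul_sum]
  exact Finset.sum_congr rfl fun x _ => by ring

lemma covP_smul {Ω : Type} [Fintype Ω] {ℓ : ℕ} (P : (Fin ℓ → Ω) → ℝ) (s t : ℝ)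
    (f g : (Fin ℓ → Ω) → ℝ) :
    covP P (fun x => s * f x) (fun x => t * g x) = s * t * covP P f g := by
  unfold covP
  rw [expP_smul, expP_smul]
  have : (fun x => s * f x * (t * g x)) = fun x => (s * t) * (f x * g x) := by
    funext x; ring
  rw [this, expP_smul]
  ring

lemma varP_sub {Ω : Type} [Fintype Ω] {ℓ : ℕ} (P : (Fin ℓ → Ω) → ℝ)
    (f g : (Fin ℓ → Ω) → ℝ) :
    varP P (fun x => f x - g x) = varP P f + varP P g - 2 * covP P f g := by
  have h1 : expP P (fun x => f x - g x) = expP P f - expP P g := by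
    unfold expP
    rw [← Finset.sum_sub_distrib]
    exact Finset.sum_congr rfl fun x _ => by ring
  have h2 : expP P (fun x => (f x - g x) * (f x - g x))
      = expP P (fun x => f x * f x) + expP P (fun x => g x * g x)
        - 2 * expP P (fun x => f x * g x) := by
    unfold expP
    rw [Finset.mul_sum, ← Finset.sum_add_distrib, ← Finset.sum_sub_distrib]
    exact Finset.sum_congr rfl fun x _ => by ring
  unfold varP covP
  rw [h1, h2]
  ring

lemma covP_le {Ω : Type} [Fintype Ω] {ℓ : ℕ} {P : (Fin ℓ → Ω) → ℝ} (hP : IsDist P)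
    (f g : (Fin ℓ → Ω) → ℝ) : 2 * covP P f g ≤ varP P f + varP P g := by
  have := varP_nonneg hP (fun x => f x - g x)
  rw [varP_sub] at this
  linarith

lemma rhoST_bdd {Ω : Type} [Fintype Ω] {ℓ : ℕ} {P : (Fin ℓ → Ω) → ℝ} (hP : IsDist P)
    (S T : Finset (Fin ℓ)) :
    BddAbove {r : ℝ | ∃ f g : (Fin ℓ → Ω) → ℝ, DependsOn f S ∧ DependsOn g T ∧
      varP P f = 1 ∧ varP P g = 1 ∧ r = covP P f g} := by
  refine ⟨1, ?_⟩
  rintro r ⟨f, g, _, _, hf, hg, rfl⟩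
  have := covP_le hP f g
  linarith

lemma rhoST_nonneg {Ω : Type} [Fintype Ω] {ℓ : ℕ} {P : (Fin ℓ → Ω) → ℝ} (hP : IsDist P)
    (S T : Finset (Fin ℓ)) : 0 ≤ rhoST P S T := by
  by_contra hneg
  have hne : {r : ℝ | ∃ f g : (Fin ℓ → Ω) → ℝ, DependsOn f S ∧ DependsOn g T ∧
      varP P f = 1 ∧ varP P g = 1 ∧ r = covP P f g}.Nonempty := by
    by_contra h
    rw [Set.not_nonempty_iff_eq_empty] at h
    apply hneg
    unfold rhoST
    rw [h, Real.sSup_empty]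
  obtain ⟨r, f, g, hf, hg, vf, vg, hr⟩ := hne
  have h1 : covP P f g ≤ rhoST P S T := le_csSup (rhoST_bdd hP S T) ⟨f, g, hf, hg, vf, vg, rfl⟩
  have h2 : covP P (fun x => (-1) * f x) (fun x => 1 * g x) ≤ rhoST P S T := by
    refine le_csSup (rhoST_bdd hP S T) ⟨_, _, ?_, ?_, ?_, ?_, rfl⟩
    · intro x y h
      simp only [hf x y h]
    · intro x y h
      simp only [hg x y h]
    · unfold varP at *
      rw [covP_smul, vf]; norm_num
    · unfold varP at *
      rw [covP_smul, vg]; norm_num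
  rw [covP_smul] at h2
  linarith

lemma rho_nonneg {Ω : Type} [Fintype Ω] {ℓ : ℕ} {P : (Fin ℓ → Ω) → ℝ} (hP : IsDist P) :
    0 ≤ rho P := Real.iSup_nonneg fun _ => rhoST_nonneg hP _ _

lemma covP_le_rho {Ω : Type} [Fintype Ω] {ℓ : ℕ} {P : (Fin ℓ → Ω) → ℝ} (hP : IsDist P)
    (j : Fin ℓ) (f g : (Fin ℓ → Ω) → ℝ) (hf : DependsOn f {j}) (hg : DependsOn g ({j}ᶜ))
    (vf : varP P f = 1) (vg : varP P g = 1) : covP P f g ≤ rho P :=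
  le_trans (le_csSup (rhoST_bdd hP _ _) ⟨f, g, hf, hg, vf, vg, rfl⟩)
    (le_ciSup (f := fun j : Fin ℓ => rhoST P {j} ({j}ᶜ)) (Set.finite_range _).bddAbove j)

/-- If `covP f g = varP g`, then `varP g ≤ ρ² varP f`. -/
lemma var_le_rho {Ω : Type} [Fintype Ω] {ℓ : ℕ} {P : (Fin ℓ → Ω) → ℝ} (hP : IsDist P)
    {ρ : ℝ} (hρ : rho P ≤ ρ)
    (j : Fin ℓ) (f g : (Fin ℓ → Ω) → ℝ) (hf : DependsOn f {j}) (hg : DependsOn g ({j}ᶜ))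
    (hc : covP P f g = varP P g) : varP P g ≤ ρ ^ 2 * varP P f := by
  have hA := varP_nonneg hP f
  have hv := varP_nonneg hP g
  rcases hv.eq_or_lt with h0 | hv
  · rw [← h0]; positivity
  have hA' : 0 < varP P f := by
    have := covP_le hP f g
    linarith
  set A := varP P f with hAd
  set v := varP P g with hvd
  have sA : 0 < √A := Real.sqrt_pos.2 hA'
  have sv : 0 < √v := Real.sqrt_pos.2 hv
  have eA : √A * √A = A := Real.mul_self_sqrt hA
  have ev : √v * √v = v := Real.mul_self_sqrt hv.le
  have key := covP_le_rho hP j (fun x => (√A)⁻¹ * f x) (fun x => (√v)⁻¹ * g x)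
    (fun x y h => by simp only [hf x y h]) (fun x y h => by simp only [hg x y h])
    (by
      unfold varP
      rw [covP_smul]
      change _ * varP P f = 1
      rw [← hAd]
      nth_rewrite 3 [← eA]
      field_simp)
    (by
      unfold varP
      rw [covP_smul]
      change _ * varP P g = 1
      rw [← hvd]
      nth_rewrite 3 [← ev]
      field_simp)
  rw [covP_smul, hc] at key
  have h1 : √v ≤ ρ * √A := by
    have h2 : (√A)⁻¹ * (√v)⁻¹ * v = √v / √A := by
      nth_rewrite 2 [← ev]
      field_simp
    rw [h2] at key
    exact (div_le_iff₀ sA).1 (key.trans hρ)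
  calc v = √v * √v := ev.symm
    _ ≤ (ρ * √A) * (ρ * √A) := mul_self_le_mul_self sv.le h1
    _ = ρ ^ 2 * A := by nth_rewrite 3 [← eA]; ring

/-! ### Double sample -/

/-- Marginal off `j`, as a function of the full tuple. -/
noncomputable def nrm {Ω : Type} [Fintype Ω] {ℓ : ℕ} (P : (Fin ℓ → Ω) → ℝ) (j : Fin ℓ)
    (x : Fin ℓ → Ω) : ℝ := ∑ a, P (Function.update x j a)

/-- The law of `(X, Z)`. -/
noncomputable def dq {Ω : Type} [Fintype Ω] {ℓ : ℕ} (P : (Fin ℓ → Ω) → ℝ) (j : Fin ℓ)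
    (x : Fin ℓ → Ω) (z : Ω) : ℝ := P x * P (Function.update x j z) / nrm P j x

/-- Conditional expectation. -/
noncomputable def cE {Ω : Type} [Fintype Ω] {ℓ : ℕ} (P : (Fin ℓ → Ω) → ℝ) (j : Fin ℓ)
    (h : Ω → ℝ) (x : Fin ℓ → Ω) : ℝ := (∑ a, P (Function.update x j a) * h a) / nrm P j x

section dq
variable {Ω : Type} [Fintype Ω] {ℓ : ℕ} {P : (Fin ℓ → Ω) → ℝ}

lemma le_nrm (hP : IsDist P) (j : Fin ℓ) (x : Fin ℓ → Ω) (z : Ω) :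
    P (Function.update x j z) ≤ nrm P j x :=
  Finset.single_le_sum (f := fun a => P (Function.update x j a))
    (fun a _ => hP.1 _) (Finset.mem_univ z)

lemma le_nrm' (hP : IsDist P) (j : Fin ℓ) (x : Fin ℓ → Ω) : P x ≤ nrm P j x := by
  simpa using le_nrm hP j x (x j)

lemma nrm_nonneg (hP : IsDist P) (j : Fin ℓ) (x : Fin ℓ → Ω) : 0 ≤ nrm P j x :=
  (hP.1 x).trans (le_nrm' hP j x)

lemma dq_nonneg (hP : IsDist P) (j : Fin ℓ) (x : Fin ℓ → Ω) (z : Ω) : 0 ≤ dq P j x z :=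
  div_nonneg (mul_nonneg (hP.1 _) (hP.1 _)) (nrm_nonneg hP j x)

lemma dq_le_left (hP : IsDist P) (j : Fin ℓ) (x : Fin ℓ → Ω) (z : Ω) : dq P j x z ≤ P x := by
  unfold dq
  exact div_le_of_le_mul₀ (nrm_nonneg hP j x) (hP.1 x)
    (mul_le_mul_of_nonneg_left (le_nrm hP j x z) (hP.1 x))

lemma dq_le_right (hP : IsDist P) (j : Fin ℓ) (x : Fin ℓ → Ω) (z : Ω) :
    dq P j x z ≤ P (Function.update x j z) := by
  unfold dq
  rw [mul_comm]
  exact div_le_of_le_mul₀ (nrm_nonneg hP j x) (hP.1 _)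
    (mul_le_mul_of_nonneg_left (le_nrm' hP j x) (hP.1 _))

lemma nrm_update (j : Fin ℓ) (x : Fin ℓ → Ω) (z : Ω) :
    nrm P j (Function.update x j z) = nrm P j x := by
  simp [nrm]

lemma dq_symm (j : Fin ℓ) (x : Fin ℓ → Ω) (z : Ω) :
    dq P j (Function.update x j z) (x j) = dq P j x z := by
  unfold dq
  rw [nrm_update, Function.update_idem, Function.update_eq_self, mul_comm]

lemma dq_sum_mul (hP : IsDist P) (j : Fin ℓ) (x : Fin ℓ → Ω) (h : Ω → ℝ) :
    ∑ z, dq P j x z * h z = P x * cE P j h x := by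
  unfold dq cE
  rw [mul_div_assoc', Finset.mul_sum, Finset.sum_div]
  exact Finset.sum_congr rfl fun z _ => by ring

lemma dq_sum (hP : IsDist P) (j : Fin ℓ) (x : Fin ℓ → Ω) : ∑ z, dq P j x z = P x := by
  have h := dq_sum_mul hP j x (fun _ => 1)
  simp only [mul_one] at h
  rw [h]
  unfold cE
  simp only [mul_one]
  change P x * (nrm P j x / nrm P j x) = P x
  rcases (hP.1 x).eq_or_lt with h0 | h0
  · rw [← h0]; simp
  · rw [div_self (h0.trans_le (le_nrm' hP j x)).ne', mul_one]

lemma dq_sum_left (hP : IsDist P) (j : Fin ℓ) (φ : (Fin ℓ → Ω) → ℝ) :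
    ∑ x, ∑ z, dq P j x z * φ x = ∑ x, P x * φ x := by
  refine Finset.sum_congr rfl fun x _ => ?_
  rw [← Finset.sum_mul, dq_sum hP]

lemma dq_swap (j : Fin ℓ) (G : (Fin ℓ → Ω) → Ω → ℝ) :
    ∑ x, ∑ z, dq P j x z * G x z
      = ∑ x, ∑ z, dq P j x z * G (Function.update x j z) (x j) := by
  rw [sum_swap_update j]
  simp_rw [dq_symm]

/-- The key one-coordinate estimate. -/
lemma key_max {π : Ω → ℝ} (hP : IsDist P) (hm : HasMarginals P π) {ρ : ℝ} (hρ : rho P ≤ ρ)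
    (j : Fin ℓ) (h : Ω → ℝ) (h01 : ∀ a, h a ∈ Set.Icc (0:ℝ) 1) :
    expPi π h + (1 - ρ ^ 2) * varPi π h
      ≤ ∑ x, ∑ z, dq P j x z * max (h (x j)) (h z) := by
  set H : (Fin ℓ → Ω) → ℝ := fun x => h (x j) with hH
  set T := cE P j h with hT
  have T_upd : ∀ x z, T (Function.update x j z) = T x := by
    intro x z
    simp only [hT, cE, nrm_update, Function.update_idem]
  have T_dep : DependsOn T ({j}ᶜ) := by
    intro x y hxy
    have : Function.update x j (y j) = y := by
      funext k
      by_cases hk : k = j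
      · subst hk; simp
      · rw [Function.update_of_ne hk]; exact hxy k (by simpa using hk)
    rw [← T_upd x (y j), this]
  have H_dep : DependsOn H {j} := by
    intro x y hxy
    simp only [hH]
    rw [hxy j (by simp)]
  -- sums
  have s1 : ∑ x, ∑ z, dq P j x z * h (x j) = expPi π h := by
    rw [dq_sum_left hP j (fun x => h (x j)), sum_pi_one hm]; rfl
  have s2 : ∑ x, ∑ z, dq P j x z * h z = expPi π h := by
    rw [dq_swap j (fun x z => h z), s1]
  have s3 : ∑ x, ∑ z, dq P j x z * (h (x j)) ^ 2 = expPi π (fun a => h a ^ 2) := by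
    rw [dq_sum_left hP j (fun x => h (x j) ^ 2), sum_pi_one hm j (fun a => h a ^ 2)]; rfl
  have s4 : ∑ x, ∑ z, dq P j x z * (h z) ^ 2 = expPi π (fun a => h a ^ 2) := by
    rw [dq_swap j (fun x z => h z ^ 2), s3]
  have s5 : ∑ x, ∑ z, dq P j x z * (h (x j) * h z) = expP P (fun x => H x * T x) := by
    unfold expP
    refine Finset.sum_congr rfl fun x _ => ?_
    have : P x * (H x * T x) = H x * (P x * cE P j h x) := by rw [hT]; ring
    rw [this, ← dq_sum_mul hP, Finset.mul_sum]
    exact Finset.sum_congr rfl fun z _ => by simp only [hH]; ring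
  have eH : expP P H = expPi π h := sum_pi_one hm j h
  have eHH : expP P (fun x => H x * H x) = expPi π (fun a => h a ^ 2) := by
    rw [← s3, dq_sum_left hP j (fun x => h (x j) ^ 2)]
    exact Finset.sum_congr rfl fun x _ => by simp only [hH]; ring
  have eT : expP P T = expPi π h := by
    rw [← s2]
    unfold expP
    refine Finset.sum_congr rfl fun x _ => ?_
    rw [dq_sum_mul hP]
  have eTT : expP P (fun x => T x * T x) = expP P (fun x => H x * T x) := by
    have a1 : expP P (fun x => T x * T x) = ∑ x, ∑ z, dq P j x z * (h z * T x) := by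
      unfold expP
      refine Finset.sum_congr rfl fun x _ => ?_
      simp_rw [← mul_assoc]
      rw [← Finset.sum_mul, dq_sum_mul hP]
    have a2 : ∑ x, ∑ z, dq P j x z * (h z * T x) = ∑ x, ∑ z, dq P j x z * (H x * T x) := by
      rw [dq_swap j (fun x z => h z * T x)]
      simp_rw [T_upd]
      rfl
    rw [a1, a2, dq_sum_left hP j (fun x => H x * T x)]
    rfl
  have hc : covP P H T = varP P T := by
    unfold varP covP
    rw [eTT, eH, eT]
  have hv := var_le_rho hP hρ j H T H_dep T_dep hc
  rw [← hc] at hv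
  have vH : varP P H = varPi π h := by
    rw [varP_eq hP, eH]
    exact sum_pi_one hm j (fun a => (h a - expPi π h) ^ 2)
  have vH2 : varP P H = expPi π (fun a => h a ^ 2) - expPi π h * expPi π h := by
    unfold varP covP
    rw [eHH, eH]
  have cHT : covP P H T = expP P (fun x => H x * T x) - expPi π h * expPi π h := by
    unfold covP
    rw [eH, eT]
  -- pointwise bound
  have pt : ∀ y z, (h y + h z + (h y ^ 2 + h z ^ 2 - 2 * (h y * h z))) / 2
      ≤ max (h y) (h z) := by
    intro y z
    have hy := h01 y
    have hz := h01 z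
    rcases le_total (h y) (h z) with hh | hh
    · rw [max_eq_right hh]
      nlinarith [hy.1, hy.2, hz.1, hz.2, mul_nonneg (sub_nonneg.2 hh) (by linarith [hy.1, hz.2] : 0 ≤ 1 - (h z - h y))]
    · rw [max_eq_left hh]
      nlinarith [hy.1, hy.2, hz.1, hz.2, mul_nonneg (sub_nonneg.2 hh) (by linarith [hz.1, hy.2] : 0 ≤ 1 - (h y - h z))]
  have lower : ∑ x, ∑ z, dq P j x z *
      ((h (x j) + h z + (h (x j) ^ 2 + h z ^ 2 - 2 * (h (x j) * h z))) / 2)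
      ≤ ∑ x, ∑ z, dq P j x z * max (h (x j)) (h z) :=
    Finset.sum_le_sum fun x _ => Finset.sum_le_sum fun z _ =>
      mul_le_mul_of_nonneg_left (pt _ _) (dq_nonneg hP j x z)
  have expand : ∑ x, ∑ z, dq P j x z *
      ((h (x j) + h z + (h (x j) ^ 2 + h z ^ 2 - 2 * (h (x j) * h z))) / 2)
      = (∑ x, ∑ z, dq P j x z * h (x j)) / 2 + (∑ x, ∑ z, dq P j x z * h z) / 2
        + (∑ x, ∑ z, dq P j x z * h (x j) ^ 2) / 2 + (∑ x, ∑ z, dq P j x z * h z ^ 2) / 2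
        - ∑ x, ∑ z, dq P j x z * (h (x j) * h z) := by
    simp_rw [Finset.sum_div, ← Finset.sum_add_distrib, ← Finset.sum_sub_distrib]
    exact Finset.sum_congr rfl fun x _ => Finset.sum_congr rfl fun z _ => by ring
  rw [expand, s1, s2, s3, s4, s5] at lower
  rw [vH] at hv vH2
  nlinarith

end dq

/-! ### Expectations of the modified functions -/

lemma exps_mono {Ω : Type} [Fintype Ω] {n : ℕ} {π : Ω → ℝ} (hπ : ∀ a : Ω, 0 < π a)
    {f g : (Fin n → Ω) → ℝ} (h : ∀ v, f v ≤ g v) : exps π f ≤ exps π g :=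
  Finset.sum_le_sum fun v _ =>
    mul_le_mul_of_nonneg_left (h v) (Finset.prod_nonneg fun i _ => (hπ _).le)

lemma exps_nonneg {Ω : Type} [Fintype Ω] {n : ℕ} {π : Ω → ℝ} (hπ : ∀ a : Ω, 0 < π a)
    {f : (Fin n → Ω) → ℝ} (h : ∀ v, 0 ≤ f v) : 0 ≤ exps π f :=
  Finset.sum_nonneg fun v _ => mul_nonneg (Finset.prod_nonneg fun i _ => (hπ _).le) (h v)

lemma exps_le_one {Ω : Type} [Fintype Ω] {n : ℕ} {π : Ω → ℝ} (hπ : ∀ a : Ω, 0 < π a)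
    (h1 : ∑ a, π a = 1) {f : (Fin n → Ω) → ℝ} (h : ∀ v, f v ≤ 1) : exps π f ≤ 1 := by
  classical
  refine (exps_mono hπ h).trans (le_of_eq ?_)
  unfold exps
  simp only [mul_one]
  have := Finset.prod_univ_sum (fun _ : Fin n => (Finset.univ : Finset Ω)) (fun _ a => π a)
  rw [Fintype.piFinset_univ] at this
  rw [← this, h1]
  simp

/-- The new family of functions after one step. -/
def stepFn {Ω : Type} {ℓ n : ℕ} (i : Fin n) (j : Fin ℓ) (x : Fin ℓ → Ω) (z : Ω)
    (g : Fin ℓ → ((Fin n → Ω) → ℝ)) : Fin ℓ → ((Fin n → Ω) → ℝ) :=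
  fun j' => if j' = j then maxOp i (x j) z (g j) else restrOp i (x j') (g j')

lemma dq_exps_restr {Ω : Type} [Fintype Ω] {ℓ n : ℕ} {P : (Fin ℓ → Ω) → ℝ} {π : Ω → ℝ}
    (hP : IsDist P) (hm : HasMarginals P π) (j j' : Fin ℓ) (i : Fin n) (g : (Fin n → Ω) → ℝ) :
    ∑ x, ∑ z, dq P j x z * exps π (restrOp i (x j') g) = exps π g := by
  rw [dq_sum_left hP j (fun x => exps π (restrOp i (x j') g)),
    sum_pi_one hm j' (fun a => exps π (restrOp i a g))]
  unfold exps restrOp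
  rw [← resample π (pi_total hP hm j) i g]
  simp_rw [Finset.mul_sum]
  rw [Finset.sum_comm]
  exact Finset.sum_congr rfl fun v _ => Finset.sum_congr rfl fun a _ => by ring

lemma dq_exps_max {Ω : Type} [Fintype Ω] {ℓ n : ℕ} {P : (Fin ℓ → Ω) → ℝ} {π : Ω → ℝ}
    (hP : IsDist P) (hm : HasMarginals P π) (hπ : ∀ a : Ω, 0 < π a) {ρ : ℝ} (hρ : rho P ≤ ρ)
    (j : Fin ℓ) (i : Fin n) (g : (Fin n → Ω) → ℝ) (g01 : ∀ v, g v ∈ Set.Icc (0:ℝ) 1) :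
    exps π g + (1 - ρ ^ 2) * influence π i g
      ≤ ∑ x, ∑ z, dq P j x z * exps π (maxOp i (x j) z g) := by
  have e1 : ∑ x, ∑ z, dq P j x z * exps π (maxOp i (x j) z g)
      = ∑ v : Fin n → Ω, (∏ k, π (v k)) * ∑ x, ∑ z, dq P j x z *
        max (g (Function.update v i (x j))) (g (Function.update v i z)) := by
    unfold exps maxOp
    simp_rw [Finset.mul_sum]
    have : ∀ x : Fin ℓ → Ω, ∑ z, ∑ v : Fin n → Ω, dq P j x z * ((∏ k, π (v k)) *
        max (g (Function.update v i (x j))) (g (Function.update v i z)))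
        = ∑ v : Fin n → Ω, ∑ z, (∏ k, π (v k)) * (dq P j x z *
        max (g (Function.update v i (x j))) (g (Function.update v i z))) := by
      intro x
      rw [Finset.sum_comm]
      exact Finset.sum_congr rfl fun v _ => Finset.sum_congr rfl fun z _ => by ring
    simp_rw [this]
    rw [Finset.sum_comm]
  have e2 : exps π g + (1 - ρ ^ 2) * influence π i g
      = ∑ v : Fin n → Ω, (∏ k, π (v k)) * (expPi π (fun a => g (Function.update v i a))
        + (1 - ρ ^ 2) * varPi π (fun a => g (Function.update v i a))) := by
    unfold influence exps
    rw [← resample π (pi_total hP hm j) i g, Finset.mul_sum, ← Finset.sum_add_distrib]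
    exact Finset.sum_congr rfl fun v _ => by unfold expPi; ring
  rw [e1, e2]
  refine Finset.sum_le_sum fun v _ => mul_le_mul_of_nonneg_left ?_
    (Finset.prod_nonneg fun i _ => (hπ _).le)
  exact key_max hP hm hρ j (fun a => g (Function.update v i a)) (fun a => g01 _)

lemma stepFn_mem {Ω : Type} {ℓ n : ℕ} (i : Fin n) (j : Fin ℓ) (x : Fin ℓ → Ω) (z : Ω)
    {g : Fin ℓ → ((Fin n → Ω) → ℝ)} (g01 : ∀ j v, g j v ∈ Set.Icc (0:ℝ) 1) (j' : Fin ℓ)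
    (v : Fin n → Ω) : stepFn i j x z g j' v ∈ Set.Icc (0:ℝ) 1 := by
  unfold stepFn
  split_ifs
  · exact ⟨le_max_of_le_left (g01 _ _).1, max_le (g01 _ _).2 (g01 _ _).2⟩
  · exact g01 _ _

lemma stepFn_ge {Ω : Type} {ℓ n : ℕ} (i : Fin n) (j : Fin ℓ) (x : Fin ℓ → Ω) (z : Ω)
    (g : Fin ℓ → ((Fin n → Ω) → ℝ)) (j' : Fin ℓ)
    (v : Fin n → Ω) : g j' (Function.update v i (x j')) ≤ stepFn i j x z g j' v := by
  unfold stepFn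
  split_ifs with h
  · subst h; exact le_max_left _ _
  · exact le_rfl

/-- Existence of a good choice for one step. -/
lemma exists_step {Ω : Type} [Fintype Ω] {ℓ n : ℕ} {P : (Fin ℓ → Ω) → ℝ} {π : Ω → ℝ}
    (hP : IsDist P) (hm : HasMarginals P π) (hπ : ∀ a : Ω, 0 < π a) {ρ : ℝ} (hρ : rho P ≤ ρ)
    (hρ2 : 0 < 1 - ρ ^ 2) {τ : ℝ} (hτ : 0 < τ)
    (j : Fin ℓ) (i : Fin n) (g : Fin ℓ → ((Fin n → Ω) → ℝ))
    (g01 : ∀ j v, g j v ∈ Set.Icc (0:ℝ) 1) (hinf : τ < influence π i (g j)) :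
    ∃ (x : Fin ℓ → Ω) (z : Ω),
      τ * (1 - ρ^2) / (2 * ℓ * (Fintype.card Ω : ℝ) ^ (ℓ + 1)) ≤ P x ∧
      τ * (1 - ρ^2) / (2 * ℓ * (Fintype.card Ω : ℝ) ^ (ℓ + 1)) ≤ P (Function.update x j z) ∧
      (∑ j', exps π (g j')) + τ * (1 - ρ^2) / 2 ≤ ∑ j', exps π (stepFn i j x z g j') := by
  set b := τ * (1 - ρ^2) / (2 * ℓ * (Fintype.card Ω : ℝ) ^ (ℓ + 1)) with hb
  set c := τ * (1 - ρ^2) with hc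
  set Φ₀ := ∑ j', exps π (g j') with hΦ₀
  have hcpos : 0 < c := mul_pos hτ hρ2
  have h1 := pi_total hP hm j
  have hℓ : 0 < (ℓ : ℝ) := by
    have : 0 < ℓ := j.pos
    exact_mod_cast this
  have hΩ : 0 < (Fintype.card Ω : ℝ) := by
    have : Nonempty Ω := by
      by_contra hne
      rw [not_nonempty_iff] at hne
      simp at h1
    exact_mod_cast Fintype.card_pos
  have hbpos : 0 ≤ b := by positivity
  have hΦ0 : 0 ≤ Φ₀ := Finset.sum_nonneg fun j' _ => exps_nonneg hπ fun v => (g01 _ _).1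
  by_contra! hcon
  have upper : ∑ x, ∑ z, dq P j x z * ∑ j', exps π (stepFn i j x z g j')
      ≤ ∑ x, ∑ z : Ω, (dq P j x z * (Φ₀ + c / 2) + b * ℓ) := by
    refine Finset.sum_le_sum fun x _ => Finset.sum_le_sum fun z _ => ?_
    have hq := dq_nonneg hP j x z
    have hΦn : 0 ≤ ∑ j', exps π (stepFn i j x z g j') :=
      Finset.sum_nonneg fun j' _ => exps_nonneg hπ fun v => (stepFn_mem i j x z g01 _ _).1
    have hΦl : ∑ j', exps π (stepFn i j x z g j') ≤ ℓ := by
      calc ∑ j', exps π (stepFn i j x z g j') ≤ ∑ j' : Fin ℓ, (1:ℝ) :=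
            Finset.sum_le_sum fun j' _ =>
              exps_le_one hπ h1 fun v => (stepFn_mem i j x z g01 _ _).2
        _ = ℓ := by simp
    by_cases hgood : b ≤ P x ∧ b ≤ P (Function.update x j z)
    · have h2 := mul_le_mul_of_nonneg_left (hcon x z hgood.1 hgood.2).le hq
      have : 0 ≤ b * ℓ := by positivity
      linarith
    · have hqb : dq P j x z ≤ b := by
        by_contra! hlt
        exact hgood ⟨(hlt.trans_le (dq_le_left hP j x z)).le,
          (hlt.trans_le (dq_le_right hP j x z)).le⟩
      have h2 := mul_le_mul hqb hΦl hΦn hbpos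
      have : 0 ≤ dq P j x z * (Φ₀ + c / 2) := by positivity
      linarith
  have upper_eq : ∑ x, ∑ z : Ω, (dq P j x z * (Φ₀ + c / 2) + b * ℓ) = Φ₀ + c := by
    simp_rw [Finset.sum_add_distrib]
    rw [dq_sum_left hP j (fun _ => Φ₀ + c / 2), ← Finset.sum_mul, hP.2]
    simp only [Finset.sum_const, Finset.card_univ, Fintype.card_fun, Fintype.card_fin,
      nsmul_eq_mul, Nat.cast_pow]
    rw [hb]
    field_simp
    ring
  have lower : Φ₀ + (1 - ρ ^ 2) * influence π i (g j)
      ≤ ∑ x, ∑ z, dq P j x z * ∑ j', exps π (stepFn i j x z g j') := by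
    have e : ∑ x, ∑ z, dq P j x z * ∑ j', exps π (stepFn i j x z g j')
        = ∑ j', ∑ x, ∑ z, dq P j x z * exps π (stepFn i j x z g j') := by
      simp_rw [Finset.mul_sum]
      have : ∀ x : Fin ℓ → Ω, ∑ z, ∑ j', dq P j x z * exps π (stepFn i j x z g j')
          = ∑ j', ∑ z, dq P j x z * exps π (stepFn i j x z g j') := fun x => Finset.sum_comm
      simp_rw [this]
      rw [Finset.sum_comm]
    rw [e, ← Finset.add_sum_erase _ _ (Finset.mem_univ j), hΦ₀,
      ← Finset.add_sum_erase _ _ (Finset.mem_univ j)]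
    have m := dq_exps_max hP hm hπ hρ j i (g j) (g01 j)
    have m2 : ∑ j' ∈ Finset.univ.erase j, ∑ x, ∑ z, dq P j x z * exps π (stepFn i j x z g j')
        = ∑ j' ∈ Finset.univ.erase j, exps π (g j') := by
      refine Finset.sum_congr rfl fun j' hj' => ?_
      simp only [stepFn, if_neg (Finset.ne_of_mem_erase hj')]
      exact dq_exps_restr hP hm j j' i (g j')
    rw [m2]
    simp only [stepFn, if_true]
    linarith
  have := mul_lt_mul_of_pos_left hinf hρ2
  linarith

/-! ### The product expectation -/

lemma prodExp_eq {Ω : Type} [Fintype Ω] {ℓ n : ℕ} (P : (Fin ℓ → Ω) → ℝ)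
    (f : Fin ℓ → ((Fin n → Ω) → ℝ)) :
    prodExp P f = ∑ Y : Fin n → Fin ℓ → Ω, (∏ i, P (Y i)) * ∏ j, f j (fun i => Y i j) := by
  unfold prodExp
  exact Equiv.sum_comp (Equiv.piComm (fun (_ : Fin ℓ) (_ : Fin n) => Ω))
    (fun Y : Fin n → Fin ℓ → Ω => (∏ i, P (Y i)) * ∏ j, f j (fun i => Y i j))

lemma prodExp_nonneg {Ω : Type} [Fintype Ω] {ℓ n : ℕ} {P : (Fin ℓ → Ω) → ℝ} (hP : IsDist P)
    {f : Fin ℓ → ((Fin n → Ω) → ℝ)} (hf : ∀ j v, 0 ≤ f j v) : 0 ≤ prodExp P f :=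
  Finset.sum_nonneg fun _ _ => mul_nonneg (Finset.prod_nonneg fun _ _ => hP.1 _)
    (Finset.prod_nonneg fun _ _ => hf _ _)

lemma prodExp_step {Ω : Type} [Fintype Ω] {ℓ n : ℕ} {P : (Fin ℓ → Ω) → ℝ} (hP : IsDist P)
    (j : Fin ℓ) (i : Fin n) (g : Fin ℓ → ((Fin n → Ω) → ℝ)) (g0 : ∀ j v, 0 ≤ g j v)
    (x : Fin ℓ → Ω) (z : Ω) {b : ℝ} (h1 : b ≤ P x) (h2 : b ≤ P (Function.update x j z)) :
    b * prodExp P (stepFn i j x z g) ≤ prodExp P g := by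
  rw [prodExp_eq, prodExp_eq]
  rw [← resample P hP.2 i (fun Y => ∏ j, g j (fun i => Y i j)), Finset.mul_sum]
  refine Finset.sum_le_sum fun Y _ => ?_
  rw [mul_left_comm]
  refine mul_le_mul_of_nonneg_left ?_ (Finset.prod_nonneg fun _ _ => hP.1 _)
  have upd : ∀ (c : Fin ℓ → Ω) (j' : Fin ℓ), (fun k => Function.update Y i c k j')
      = Function.update (fun k => Y k j') i (c j') := by
    intro c j'
    funext k
    by_cases hk : k = i
    · subst hk; simp
    · simp [Function.update_of_ne hk]
  simp_rw [upd]
  have single : ∀ c : Fin ℓ → Ω, P c * ∏ j', g j' (Function.update (fun k => Y k j') i (c j'))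
      ≤ ∑ c, P c * ∏ j', g j' (Function.update (fun k => Y k j') i (c j')) := fun c =>
    Finset.single_le_sum
      (f := fun c : Fin ℓ → Ω => P c * ∏ j', g j' (Function.update (fun k => Y k j') i (c j')))
      (fun c _ => mul_nonneg (hP.1 c) (Finset.prod_nonneg fun _ _ => g0 _ _)) (Finset.mem_univ c)
  have main : ∀ c : Fin ℓ → Ω, b ≤ P c →
      (∀ j', stepFn i j x z g j' (fun k => Y k j')
        = g j' (Function.update (fun k => Y k j') i (c j'))) →
      b * ∏ j', stepFn i j x z g j' (fun k => Y k j')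
        ≤ ∑ c, P c * ∏ j', g j' (Function.update (fun k => Y k j') i (c j')) := by
    intro c hc he
    refine le_trans ?_ (single c)
    simp_rw [he]
    exact mul_le_mul_of_nonneg_right hc (Finset.prod_nonneg fun _ _ => g0 _ _)
  rcases le_total (g j (Function.update (fun k => Y k j) i z))
      (g j (Function.update (fun k => Y k j) i (x j))) with hle | hle
  · refine main x h1 fun j' => ?_
    unfold stepFn
    split_ifs with h
    · subst h; exact max_eq_left hle
    · rfl
  · refine main _ h2 fun j' => ?_
    unfold stepFn
    split_ifs with h
    · subst h; rw [Function.update_self]; exact max_eq_right hle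
    · rw [Function.update_of_ne h]; rfl

lemma restrict_step {Ω : Type} {n : ℕ} (R : Fin n → Option Ω) (i : Fin n) (a : Ω) :
    ∃ R' : Fin n → Option Ω, restSize R' ≤ restSize R + 1 ∧
      ∀ (f : (Fin n → Ω) → ℝ) v, restrict R' f v = restrict R f (Function.update v i a) := by
  refine ⟨Function.update R i (some ((R i).getD a)), ?_, ?_⟩
  · unfold restSize
    refine le_trans (Finset.card_le_card (t := insert i
      (Finset.univ.filter (fun k => (R k).isSome = true))) ?_) (Finset.card_insert_le _ _)
    intro k hk
    by_cases hki : k = i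
    · simp [hki]
    · simpa [hki, Function.update_of_ne hki] using hk
  · intro f v
    unfold restrict
    congr 1
    funext k
    by_cases hki : k = i
    · subst hki; simp
    · simp [Function.update_of_ne hki]

/-- reduction from resilient functions to low-influence functions. -/
theorem low_influence_reduction
    {Ω : Type} [Fintype Ω] {ℓ : ℕ}
    (P : (Fin ℓ → Ω) → ℝ) (π : Ω → ℝ)
    (hP : IsDist P) (hm : HasMarginals P π) (hπ : ∀ a : Ω, 0 < π a)
    (ρ : ℝ) (hρ : rho P ≤ ρ) (hρ1 : ρ < 1)
    (τ : ℝ) (hτ : 0 < τ) :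
    ∀ ε : ℝ, ε ∈ Set.Icc (0:ℝ) 1 →
    ∀ n : ℕ, 1 ≤ n →
    ∀ f : Fin ℓ → ((Fin n → Ω) → ℝ),
      (∀ j v, f j v ∈ Set.Icc (0:ℝ) 1) →
      (∀ j, Resilient π ε ⌊2 * (ℓ:ℝ) / (τ * (1 - ρ^2))⌋₊ (f j)) →
      ∃ g : Fin ℓ → ((Fin n → Ω) → ℝ),
        (∀ j v, g j v ∈ Set.Icc (0:ℝ) 1) ∧
        (∀ (j : Fin ℓ) (i : Fin n), influence π i (g j) ≤ τ) ∧
        (τ * (1 - ρ^2) / (2 * ℓ * (Fintype.card Ω : ℝ) ^ (ℓ + 1)))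
            ^ ⌊2 * (ℓ:ℝ) / (τ * (1 - ρ^2))⌋₊ * prodExp P g ≤ prodExp P f ∧
        (∀ j, (1 - ε) * exps π (f j) ≤ exps π (g j)) := by
  intro ε hε n hn f f01 hres
  set k := ⌊2 * (ℓ:ℝ) / (τ * (1 - ρ^2))⌋₊ with hk
  set b := τ * (1 - ρ^2) / (2 * ℓ * (Fintype.card Ω : ℝ) ^ (ℓ + 1)) with hb
  have hρ0 : 0 ≤ ρ := (rho_nonneg hP).trans hρ
  have hρ2 : 0 < 1 - ρ ^ 2 := by nlinarith
  have hc : 0 < τ * (1 - ρ ^ 2) := mul_pos hτ hρ2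
  have hb0 : 0 ≤ b := by positivity
  by_contra hcon
  rcases Nat.eq_zero_or_pos ℓ with hℓ | hℓ
  · subst hℓ
    refine hcon ⟨f, f01, fun j => j.elim0, ?_, fun j => j.elim0⟩
    have : k = 0 := by simp [hk]
    rw [this]; simp
  have h1 := pi_total hP hm ⟨0, hℓ⟩
  have hΩ : 1 ≤ (Fintype.card Ω : ℝ) := by
    have : Nonempty Ω := by
      by_contra hne
      rw [not_nonempty_iff] at hne
      simp at h1
    exact_mod_cast Fintype.card_pos
  have hℓ' : 0 < (ℓ : ℝ) := by exact_mod_cast hℓ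
  have hpow : ∀ t ≤ k, b ^ k ≤ b ^ t := by
    intro t ht
    rcases Nat.eq_zero_or_pos k with h0 | h0
    · have : t = 0 := by omega
      rw [this, h0]
    · refine pow_le_pow_of_le_one hb0 ?_ ht
      have h2 : (1:ℝ) ≤ 2 * (ℓ:ℝ) / (τ * (1 - ρ^2)) := by
        have : 1 ≤ k := h0
        rw [hk, Nat.one_le_floor_iff] at this
        exact this
      rw [le_div_iff₀ hc] at h2
      rw [hb]
      refine div_le_one_of_le₀ ?_ (by positivity)
      have h3 : 1 ≤ (Fintype.card Ω : ℝ) ^ (ℓ + 1) := one_le_pow₀ hΩ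
      nlinarith
  have bound : ∀ (t : ℕ) (g : Fin ℓ → ((Fin n → Ω) → ℝ)), (∀ j v, g j v ∈ Set.Icc (0:ℝ) 1) →
      (∑ j, exps π (f j)) + t * (τ * (1 - ρ ^ 2) / 2) ≤ ∑ j, exps π (g j) → t ≤ k := by
    intro t g g01 hg
    have hu : ∑ j, exps π (g j) ≤ ℓ := by
      calc ∑ j, exps π (g j) ≤ ∑ j' : Fin ℓ, (1:ℝ) :=
            Finset.sum_le_sum fun j' _ => exps_le_one hπ h1 fun v => (g01 _ _).2
        _ = ℓ := by simp
    have hl : 0 ≤ ∑ j, exps π (f j) :=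
      Finset.sum_nonneg fun j' _ => exps_nonneg hπ fun v => (f01 _ _).1
    rw [hk]
    refine Nat.le_floor ?_
    rw [le_div_iff₀ hc]
    linarith
  have iter : ∀ t : ℕ, ∃ g : Fin ℓ → ((Fin n → Ω) → ℝ), (∀ j v, g j v ∈ Set.Icc (0:ℝ) 1) ∧
      b ^ t * prodExp P g ≤ prodExp P f ∧
      (∀ j, ∃ R : Fin n → Option Ω, restSize R ≤ t ∧ ∀ v, restrict R (f j) v ≤ g j v) ∧
      (∑ j, exps π (f j)) + t * (τ * (1 - ρ ^ 2) / 2) ≤ ∑ j, exps π (g j) := by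
    intro t
    induction t with
    | zero =>
      refine ⟨f, f01, by simp, fun j => ⟨fun _ => none, by simp [restSize], fun v => ?_⟩, by simp⟩
      simp [restrict]
    | succ t ih =>
      obtain ⟨g, g01, hg, hR, hΦ⟩ := ih
      have htk := bound t g g01 hΦ
      have hinf : ∃ j i, τ < influence π i (g j) := by
        by_contra! hno
        refine hcon ⟨g, g01, hno, ?_, fun j => ?_⟩
        · exact (mul_le_mul_of_nonneg_right (hpow t htk)
            (prodExp_nonneg hP fun j v => (g01 j v).1)).trans hg
        · obtain ⟨R, hRs, hRl⟩ := hR j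
          exact (hres j R (hRs.trans htk)).1.trans (exps_mono hπ hRl)
      obtain ⟨j, i, hji⟩ := hinf
      obtain ⟨x, z, hx, hz, hstep⟩ := exists_step hP hm hπ hρ hρ2 hτ j i g g01 hji
      refine ⟨stepFn i j x z g, stepFn_mem i j x z g01, ?_, fun j' => ?_, ?_⟩
      · have := prodExp_step hP j i g (fun j v => (g01 j v).1) x z hx hz
        have h3 := mul_le_mul_of_nonneg_left this (pow_nonneg hb0 t)
        rw [pow_succ, mul_assoc]
        exact h3.trans hg
      · obtain ⟨R, hRs, hRl⟩ := hR j'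
        obtain ⟨R', hs', he'⟩ := restrict_step R i (x j')
        refine ⟨R', by omega, fun v => ?_⟩
        rw [he']
        exact (hRl _).trans (stepFn_ge i j x z g j' v)
      · push_cast
        linarith
  obtain ⟨g, g01, -, -, hΦ⟩ := iter (k + 1)
  have := bound (k + 1) g g01 hΦ
  omega

end SameSetHitting
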